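/- Let r ≥ 1 and let X ∈ GL_r(ℤ) with complex eigenvalues λ_1, …, λ_r (listed with multiplicity, not necessarily distinct). For each n ≥ 1 let d_n ∈ ℤ be the integer satisfying (d_n : ℂ) = n² · (det X)^{n−1} · ∏_{1 ≤ i < j ≤ r} (∑_{k=0}^{n−1} λ_i^k λ_j^{n−1−k})². Then for all n, m ≥ 1, if n divides m then d_n divides d_m in ℤ. -/

import Mathlib

open Polynomial Finset

theorem geom_aux (x y : ℂ) (n t : ℕ) (hn : 1 ≤ n) (ht : 1 ≤ t) :
    (∑ k ∈ Finset.range (n * t), x ^ k * y ^ (n * t - 1 - k)) =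
    (∑ k ∈ Finset.range n, x ^ k * y ^ (n - 1 - k)) *
    (∑ k ∈ Finset.range t, (x ^ n) ^ k * (y ^ n) ^ (t - 1 - k)) := by
  by_cases h : x = y
  · subst h
    have key : ∀ (z : ℂ) (N : ℕ), (∑ k ∈ Finset.range N, z ^ k * z ^ (N - 1 - k)) =
        N * z ^ (N - 1) := by
      intro z N
      rw [Finset.sum_congr rfl (g := fun _ => z ^ (N - 1))]
      · simp
      · intro k hk
        have := Finset.mem_range.1 hk
        rw [← pow_add]
        congr 1
        omega
    rw [key, key, key]
    obtain ⟨a, rfl⟩ := Nat.exists_eq_add_of_le' hn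
    obtain ⟨b, rfl⟩ := Nat.exists_eq_add_of_le' ht
    have : (a + 1) * (b + 1) - 1 = a + (a + 1) * b := by
      rw [Nat.mul_add]; omega
    rw [this, pow_add, pow_mul]
    push_cast
    ring
  · have h' : x - y ≠ 0 := sub_ne_zero.2 h
    apply mul_right_cancel₀ h'
    rw [(Commute.all x y).geom_sum₂_mul, mul_right_comm, (Commute.all x y).geom_sum₂_mul, mul_comm (x ^ n - y ^ n),
      (Commute.all (x ^ n) (y ^ n)).geom_sum₂_mul, pow_mul, pow_mul]

/-- For `X ∈ GL_r(ℤ)` with complex eigenvalues `λ_1, …, λ_r`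
(with multiplicity), the integers `d_n` with
`(d_n : ℂ) = n² (det X)^{n-1} ∏_{i<j} (∑_{k<n} λ_i^k λ_j^{n-1-k})²`
form a divisibility sequence. -/
theorem stmt_3 (r : ℕ) (hr : 1 ≤ r) (X : Matrix (Fin r) (Fin r) ℤ)
    (hX : IsUnit X.det) (lam : Fin r → ℂ)
    (hchar : X.charpoly.map (Int.castRingHom ℂ) =
      ∏ i : Fin r, (Polynomial.X - Polynomial.C (lam i)))
    (d : ℕ → ℤ)
    (hd : ∀ n, 1 ≤ n → (d n : ℂ) =
      (n : ℂ) ^ 2 * (X.det : ℂ) ^ (n - 1) *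
        ∏ i : Fin r, ∏ j ∈ Finset.Ioi i,
          (∑ k ∈ Finset.range n, lam i ^ k * lam j ^ (n - 1 - k)) ^ 2) :
    ∀ n m : ℕ, 1 ≤ n → 1 ≤ m → n ∣ m → d n ∣ d m := by
  intro n m hn hm ⟨t, hmt⟩
  subst hmt
  have ht : 1 ≤ t := by
    rcases Nat.eq_zero_or_pos t with h | h
    · subst h; simp at hm
    · exact h
  have hint : ∀ i, IsIntegral ℤ (lam i) := by
    intro i
    refine ⟨X.charpoly, X.charpoly_monic, ?_⟩
    have h1 : Polynomial.eval (lam i) (X.charpoly.map (Int.castRingHom ℂ)) = 0 := by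
      rw [hchar, Polynomial.eval_prod]
      exact Finset.prod_eq_zero (Finset.mem_univ i) (by simp)
    rw [Polynomial.eval_map] at h1
    exact h1
  set q : ℂ := (t : ℂ) ^ 2 * (X.det : ℂ) ^ (n * t - n) *
        ∏ i : Fin r, ∏ j ∈ Finset.Ioi i,
          (∑ k ∈ Finset.range t, (lam i ^ n) ^ k * (lam j ^ n) ^ (t - 1 - k)) ^ 2 with hq
  have hqint : IsIntegral ℤ q := by
    refine IsIntegral.mul (IsIntegral.mul (IsIntegral.pow ?_ _) (IsIntegral.pow ?_ _)) ?_
    · exact_mod_cast isIntegral_algebraMap (R := ℤ) (A := ℂ) (x := (t : ℤ))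
    · exact isIntegral_algebraMap (R := ℤ) (A := ℂ) (x := X.det)
    · refine IsIntegral.prod _ fun i _ => IsIntegral.prod _ fun j _ => IsIntegral.pow ?_ _
      exact IsIntegral.sum _ fun k _ => (((hint i).pow _).pow _).mul (((hint j).pow _).pow _)
  have hfac : (d (n * t) : ℂ) = d n * q := by
    rw [hd _ hm, hd _ hn, hq]
    have hle : n ≤ n * t := Nat.le_mul_of_pos_right n ht
    have hexp : n * t - 1 = (n - 1) + (n * t - n) := by omega
    have hprod : (∏ i : Fin r, ∏ j ∈ Finset.Ioi i,
          (∑ k ∈ Finset.range (n * t), lam i ^ k * lam j ^ (n * t - 1 - k)) ^ 2) =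
        (∏ i : Fin r, ∏ j ∈ Finset.Ioi i,
          (∑ k ∈ Finset.range n, lam i ^ k * lam j ^ (n - 1 - k)) ^ 2) *
        ∏ i : Fin r, ∏ j ∈ Finset.Ioi i,
          (∑ k ∈ Finset.range t, (lam i ^ n) ^ k * (lam j ^ n) ^ (t - 1 - k)) ^ 2 := by
      simp only [geom_aux _ _ n t hn ht, mul_pow, Finset.prod_mul_distrib]
    rw [hprod, hexp, pow_add]
    push_cast
    ring
  clear_value q
  by_cases h0 : d n = 0
  · have : d (n * t) = 0 := by
      rw [h0] at hfac
      simpa using hfac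
    rw [this]
    exact dvd_zero _
  · have h0' : (d n : ℂ) ≠ 0 := by exact_mod_cast h0
    have hqe : q = algebraMap ℚ ℂ ((d (n * t) : ℚ) / d n) := by
      simp only [eq_ratCast]
      push_cast
      rw [hfac]
      field_simp
    rw [hqe] at hqint
    have hqi := (isIntegral_algebraMap_iff (algebraMap ℚ ℂ).injective).1 hqint
    obtain ⟨z, hz⟩ := IsIntegrallyClosed.isIntegral_iff.1 hqi
    refine ⟨z, ?_⟩
    have h0q : (d n : ℚ) ≠ 0 := by exact_mod_cast h0
    simp only [eq_intCast] at hz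
    rw [eq_div_iff h0q] at hz
    rw [mul_comm (d n)]
    exact_mod_cast hz.symm
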